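/- Let △̄ = (Δ₁, Δ₂, Δ₃) be a strip of three triangles and A = {A₁, A₂, B, C₁, C₂} with A₁ ≠ A₂ in Δ₁, B ∈ Δ₂, and C₁ ≠ C₂ in Δ₃, such that the line through A₁ and A₂ does not intersect Δ₂ and the line through C₁ and C₂ does not intersect Δ₂ (the basic problem of type "2+1+2/B"). Then {△̄, A} is poised. -/

import Mathlib

open scoped Classical

noncomputable section

/-- Points of the plane. -/
abbrev E : Type := ℝ × ℝ

/-- The closed triangle `Δᵢ` with vertices `V i`, `V (i+1)`, `V (i+2)`. -/
def tri (V : ℕ → E) (i : ℕ) : Set E :=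
  convexHull ℝ {V i, V (i + 1), V (i + 2)}

/-- `V 1, …, V (n+2)` are the vertices of a strip of `n` triangles
`Δ₁, …, Δₙ`, where `Δᵢ = [Vᵢ, Vᵢ₊₁, Vᵢ₊₂]`. -/
structure IsStrip (n : ℕ) (V : ℕ → E) : Prop where
  indep : ∀ i, 1 ≤ i → i ≤ n → AffineIndependent ℝ ![V i, V (i + 1), V (i + 2)]
  adj : ∀ i, 1 ≤ i → i + 1 ≤ n →
    tri V i ∩ tri V (i + 1) = segment ℝ (V (i + 1)) (V (i + 2))
  touch : ∀ i, 1 ≤ i → i + 2 ≤ n → tri V i ∩ tri V (i + 2) = {V (i + 2)}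
  disj : ∀ i j, 1 ≤ i → j ≤ n → i + 3 ≤ j → tri V i ∩ tri V j = ∅

/-- The underlying set `|△̄ₖᵐ|` of the (sub)strip consisting of the triangles
`Δ k, …, Δ m`. -/
def stripSet (V : ℕ → E) (k m : ℕ) : Set E :=
  ⋃ i ∈ Finset.Icc k m, tri V i

/-- The space `S(△̄ₖᵐ)` of continuous functions on the strip `|△̄ₖᵐ|` whose
restriction to each triangle `Δᵢ`, `k ≤ i ≤ m`, agrees with an affine
function `ℝ² → ℝ`. -/
def stripSpace (V : ℕ → E) (k m : ℕ) : Submodule ℝ (stripSet V k m → ℝ) where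
  carrier := {s | Continuous s ∧ ∀ i ∈ Finset.Icc k m, ∃ f : E →ᵃ[ℝ] ℝ,
    ∀ x : stripSet V k m, (x : E) ∈ tri V i → s x = f x}
  add_mem' := by
    rintro a b ⟨hca, ha⟩ ⟨hcb, hb⟩
    refine ⟨hca.add hcb, fun i hi => ?_⟩
    obtain ⟨f, hf⟩ := ha i hi
    obtain ⟨g, hg⟩ := hb i hi
    exact ⟨f + g, fun x hx => by simp [hf x hx, hg x hx]⟩
  zero_mem' := ⟨continuous_const, fun i hi => ⟨0, fun x hx => by simp⟩⟩
  smul_mem' := by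
    rintro c a ⟨hca, ha⟩
    refine ⟨hca.const_smul c, fun i hi => ?_⟩
    obtain ⟨f, hf⟩ := ha i hi
    exact ⟨c • f, fun x hx => by simp [hf x hx]⟩

/-- Poisedness of a node set `A` for a subspace `T` of the functions on the
strip `|△̄ₖᵐ|`: for every data `c` there is a unique `s ∈ T` interpolating
`c` at the nodes. -/
def PoisedFor (V : ℕ → E) (k m : ℕ) (T : Submodule ℝ (stripSet V k m → ℝ))
    (A : Finset E) : Prop :=
  ∀ c : E → ℝ, ∃! s : stripSet V k m → ℝ,
    s ∈ T ∧ ∀ a : stripSet V k m, (a : E) ∈ A → s a = c a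

/-- Poisedness of the interpolation problem `{△̄ₖᵐ, A}`. -/
def Poised (V : ℕ → E) (k m : ℕ) (A : Finset E) : Prop :=
  PoisedFor V k m (stripSpace V k m) A

/-- The node set `Aₖᵐ = A ∩ |△̄ₖᵐ|` of the subproblem `{△̄, A}ₖᵐ`. -/
def nodesIn (V : ℕ → E) (k m : ℕ) (A : Finset E) : Finset E :=
  A.filter (fun x => x ∈ stripSet V k m)

/-- The nodes of `A` lying in the triangle `Δᵢ`. -/
def triNodes (V : ℕ → E) (i : ℕ) (A : Finset E) : Finset E :=
  A.filter (fun x => x ∈ tri V i)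

/-- An affinely independent triple in the plane, as an affine basis. -/
def planeBasis (p : Fin 3 → E) (hp : AffineIndependent ℝ p) : AffineBasis (Fin 3) ℝ E :=
  ⟨p, hp, hp.affineSpan_eq_top_iff_card_eq_finrank_add_one.2 (by simp)⟩

theorem affineMap_eq_sum_coord (p : Fin 3 → E) (hp : AffineIndependent ℝ p)
    (f : E →ᵃ[ℝ] ℝ) (x : E) :
    f x = ∑ i, f (p i) * (planeBasis p hp).coord i x := by
  have hs := (planeBasis p hp).sum_coord_apply_eq_one x
  have h := congrArg f ((planeBasis p hp).affineCombination_coord_eq_self x)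
  rw [Finset.map_affineCombination _ _ _ hs,
    Finset.affineCombination_eq_linear_combination _ _ _ hs] at h
  rw [← h]
  exact Finset.sum_congr rfl fun i _ => mul_comm _ _

theorem affineMap_eq_zero_of_vanish (P Q R : E) (hp : AffineIndependent ℝ ![P, Q, R])
    (f : E →ᵃ[ℝ] ℝ) (hP : f P = 0) (hQ : f Q = 0) (hR : f R = 0) (x : E) : f x = 0 := by
  rw [affineMap_eq_sum_coord _ hp f x]
  simp [Fin.sum_univ_three, hP, hQ, hR]

/-- An affine function vanishing at two points whose line misses a convex set is either zero
or of constant strict sign on that set. -/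
theorem affineMap_eq_zero_or_sameSign (K : Set E) (hK : Convex ℝ K) (P Q : E) (hPQ : P ≠ Q)
    (hl : (↑(affineSpan ℝ {P, Q}) ∩ K : Set E) = ∅) (f : E →ᵃ[ℝ] ℝ)
    (hP : f P = 0) (hQ : f Q = 0) :
    (∀ x, f x = 0) ∨ ∀ x ∈ K, ∀ y ∈ K, 0 < f x * f y := by
  by_cases h : ∃ x ∈ K, f x = 0
  · obtain ⟨x, hx, hfx⟩ := h
    have hxl : x ∉ affineSpan ℝ {P, Q} := fun hm => by
      have : x ∈ (↑(affineSpan ℝ {P, Q}) ∩ K : Set E) := ⟨hm, hx⟩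
      rw [hl] at this
      exact this
    exact .inl (affineMap_eq_zero_of_vanish P Q x
      (affineIndependent_of_ne_of_mem_of_mem_of_notMem hPQ
        (left_mem_affineSpan_pair ℝ P Q) (right_mem_affineSpan_pair ℝ P Q) hxl) f hP hQ hfx)
  · right
    push Not at h
    have hc : (f '' K).OrdConnected := (hK.affine_image f).ordConnected
    have key : ∀ x ∈ K, ∀ y ∈ K, ¬ (f x < 0 ∧ 0 < f y) := fun x hx y hy hxy => by
      obtain ⟨z, hz, hfz⟩ := hc.out ⟨x, hx, rfl⟩ ⟨y, hy, rfl⟩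
        (⟨hxy.1.le, hxy.2.le⟩ : (0 : ℝ) ∈ Set.Icc (f x) (f y))
      exact h z hz hfz
    intro x hx y hy
    rcases lt_or_gt_of_ne (h x hx) with h1 | h1 <;> rcases lt_or_gt_of_ne (h y hy) with h2 | h2
    · exact mul_pos_of_neg_of_neg h1 h2
    · exact (key x hx y hy ⟨h1, h2⟩).elim
    · exact (key y hy x hx ⟨h2, h1⟩).elim
    · exact mul_pos h1 h2

theorem tri_vertices_mem (V : ℕ → E) (i : ℕ) :
    V i ∈ tri V i ∧ V (i + 1) ∈ tri V i ∧ V (i + 2) ∈ tri V i :=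
  ⟨subset_convexHull ℝ _ (by simp), subset_convexHull ℝ _ (by simp),
    subset_convexHull ℝ _ (by simp)⟩

theorem tri_isClosed (V : ℕ → E) (i : ℕ) : IsClosed (tri V i) :=
  (Set.Finite.isCompact_convexHull ℝ (Set.toFinite _)).isClosed

theorem tri_subset_stripSet (V : ℕ → E) {k m i : ℕ} (hi : i ∈ Finset.Icc k m) :
    tri V i ⊆ stripSet V k m :=
  fun _ hx => Set.mem_iUnion₂.2 ⟨i, hi, hx⟩

/-- Affine pieces that agree at the shared vertices and vanish at the nodes are zero. -/
theorem pieces_eq_zero (V : ℕ → E) (hV : IsStrip 3 V) (A₁ A₂ B C₁ C₂ : E)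
    (hA : A₁ ≠ A₂) (hB : B ∈ tri V 2) (hC : C₁ ≠ C₂)
    (hlA : (↑(affineSpan ℝ {A₁, A₂}) ∩ tri V 2 : Set E) = ∅)
    (hlC : (↑(affineSpan ℝ {C₁, C₂}) ∩ tri V 2 : Set E) = ∅)
    (f g h : E →ᵃ[ℝ] ℝ) (fg2 : f (V 2) = g (V 2)) (fg3 : f (V 3) = g (V 3))
    (gh3 : g (V 3) = h (V 3)) (gh4 : g (V 4) = h (V 4))
    (hfA₁ : f A₁ = 0) (hfA₂ : f A₂ = 0) (hgB : g B = 0) (hhC₁ : h C₁ = 0) (hhC₂ : h C₂ = 0) :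
    (∀ x, f x = 0) ∧ (∀ x, g x = 0) ∧ ∀ x, h x = 0 := by
  obtain ⟨m2, m3, m4⟩ := tri_vertices_mem V 2
  norm_num at m3 m4
  have hK : Convex ℝ (tri V 2) := convex_convexHull ℝ _
  have hf := affineMap_eq_zero_or_sameSign _ hK A₁ A₂ hA hlA f hfA₁ hfA₂
  have hh := affineMap_eq_zero_or_sameSign _ hK C₁ C₂ hC hlC h hhC₁ hhC₂
  rcases hf with hf | hf <;> rcases hh with hh | hh
  · exact ⟨hf, affineMap_eq_zero_of_vanish _ _ _ (hV.indep 2 (by norm_num) (by norm_num)) g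
      (by rw [← fg2, hf]) (by rw [← fg3, hf]) (by rw [gh4, hh]), hh⟩
  · have := hh _ m3 _ m3
    rw [← gh3, ← fg3, hf] at this
    simp at this
  · have := hf _ m3 _ m3
    rw [fg3, gh3, hh] at this
    simp at this
  · have hpos : tri V 2 ⊆ (g (V 3) • g : E →ᵃ[ℝ] ℝ) ⁻¹' Set.Ioi 0 := by
      refine convexHull_min ?_ ((convex_Ioi 0).affine_preimage _)
      have h2 := hf _ m3 _ m2
      have h3 := hf _ m3 _ m3
      have h4 := hh _ m3 _ m4
      rw [fg3, fg2] at h2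
      rw [fg3] at h3
      rw [← gh3, ← gh4] at h4
      rintro x (rfl | rfl | rfl)
      exacts [h2, h3, h4]
    have := hpos hB
    simp [hgB] at this

/-- Affine functions on the three triangles agreeing at the shared vertices glue to an
element of the spline space. -/
theorem exists_glue (V : ℕ → E) (hV : IsStrip 3 V) (f g h : E →ᵃ[ℝ] ℝ)
    (fg2 : f (V 2) = g (V 2)) (fg3 : f (V 3) = g (V 3))
    (gh3 : g (V 3) = h (V 3)) (gh4 : g (V 4) = h (V 4)) :
    ∃ s ∈ stripSpace V 1 3, (∀ x : stripSet V 1 3, (x : E) ∈ tri V 1 → s x = f x) ∧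
      (∀ x : stripSet V 1 3, (x : E) ∈ tri V 2 → s x = g x) ∧
      ∀ x : stripSet V 1 3, (x : E) ∈ tri V 3 → s x = h x := by
  have eqOn_segment : ∀ (a b : E →ᵃ[ℝ] ℝ) (P Q : E), a P = b P → a Q = b Q →
      ∀ x ∈ segment ℝ P Q, a x = b x := by
    intro a b P Q hP hQ x hx
    rw [segment_eq_image_lineMap] at hx
    obtain ⟨t, -, rfl⟩ := hx
    rw [AffineMap.apply_lineMap, AffineMap.apply_lineMap, hP, hQ]
  have h12 : ∀ x, x ∈ tri V 1 → x ∈ tri V 2 → f x = g x := fun x h1 h2 =>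
    eqOn_segment f g _ _ fg2 fg3 x ((hV.adj 1 (by norm_num) (by norm_num)).subset ⟨h1, h2⟩)
  have h23 : ∀ x, x ∈ tri V 2 → x ∈ tri V 3 → g x = h x := fun x h1 h2 =>
    eqOn_segment g h _ _ gh3 gh4 x ((hV.adj 2 (by norm_num) (by norm_num)).subset ⟨h1, h2⟩)
  have h13 : ∀ x, x ∈ tri V 1 → x ∈ tri V 3 → f x = h x := fun x h1 h2 => by
    obtain rfl : x = V 3 := (hV.touch 1 (by norm_num) (by norm_num)).subset ⟨h1, h2⟩
    exact fg3.trans gh3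
  let s : stripSet V 1 3 → ℝ := fun x =>
    if (x : E) ∈ tri V 1 then f x else if (x : E) ∈ tri V 2 then g x else h x
  have s1 : ∀ x : stripSet V 1 3, (x : E) ∈ tri V 1 → s x = f x := fun x hx => by
    simp [s, hx]
  have s2 : ∀ x : stripSet V 1 3, (x : E) ∈ tri V 2 → s x = g x := fun x hx => by
    by_cases h1 : (x : E) ∈ tri V 1
    · rw [s1 x h1, h12 x h1 hx]
    · simp [s, h1, hx]
  have s3 : ∀ x : stripSet V 1 3, (x : E) ∈ tri V 3 → s x = h x := fun x hx => by
    by_cases h1 : (x : E) ∈ tri V 1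
    · rw [s1 x h1, h13 x h1 hx]
    · by_cases h2 : (x : E) ∈ tri V 2
      · rw [s2 x h2, h23 x h2 hx]
      · simp [s, h1, h2]
  have pieces : ∀ i ∈ Finset.Icc 1 3, ∃ a : E →ᵃ[ℝ] ℝ,
      ∀ x : stripSet V 1 3, (x : E) ∈ tri V i → s x = a x := by
    intro i hi
    rw [Finset.mem_Icc] at hi
    obtain ⟨hi1, hi3⟩ := hi
    interval_cases i
    exacts [⟨f, s1⟩, ⟨g, s2⟩, ⟨h, s3⟩]
  refine ⟨s, ⟨?_, pieces⟩, s1, s2, s3⟩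
  refine (locallyFinite_of_finite
    (fun i : Finset.Icc 1 3 => ((↑) : stripSet V 1 3 → E) ⁻¹' tri V i)).continuous ?_
    (fun i => (tri_isClosed V i).preimage continuous_subtype_val) fun i => ?_
  · refine Set.eq_univ_of_forall fun x => ?_
    obtain ⟨i, hi, hx⟩ := Set.mem_iUnion₂.1 x.2
    exact Set.mem_iUnion.2 ⟨⟨i, hi⟩, hx⟩
  · obtain ⟨a, ha⟩ := pieces i i.2
    exact (a.continuous_of_finiteDimensional.comp continuous_subtype_val).continuousOn.congr
      fun x hx => ha x hx

/-- The affine function with prescribed values at the points of an affinely independent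
triple, depending linearly on the values. -/
def planeInterp (p : Fin 3 → E) (hp : AffineIndependent ℝ p) (e : Fin 3 → Fin 5) :
    (Fin 5 → ℝ) →ₗ[ℝ] E →ᵃ[ℝ] ℝ :=
  ∑ i, (LinearMap.proj (e i) : (Fin 5 → ℝ) →ₗ[ℝ] ℝ).smulRight ((planeBasis p hp).coord i)

theorem planeInterp_vertex (p : Fin 3 → E) (hp : AffineIndependent ℝ p) (e : Fin 3 → Fin 5)
    (w : Fin 5 → ℝ) (j : Fin 3) : planeInterp p hp e w (p j) = w (e j) := by
  have hc : ∀ i, (planeBasis p hp).coord i (p j) = if i = j then 1 else 0 :=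
    fun i => (planeBasis p hp).coord_apply i j
  have hs : planeInterp p hp e w (p j) = ∑ i, w (e i) * (planeBasis p hp).coord i (p j) := by
    simp [planeInterp, Fin.sum_univ_three]
  simp [hs, hc]

/-- the basic problem "2+1+2/B" is poised: a strip of three
triangles with two nodes in `Δ₁`, one in `Δ₂`, two in `Δ₃`, such that the
line through the two nodes in `Δ₁` (resp. `Δ₃`) does not meet `Δ₂`. -/
theorem basic_212B_poised (V : ℕ → E) (hV : IsStrip 3 V)
    (A₁ A₂ B C₁ C₂ : E)
    (hA₁ : A₁ ∈ tri V 1) (hA₂ : A₂ ∈ tri V 1) (hA : A₁ ≠ A₂)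
    (hB : B ∈ tri V 2)
    (hC₁ : C₁ ∈ tri V 3) (hC₂ : C₂ ∈ tri V 3) (hC : C₁ ≠ C₂)
    (hlA : (↑(affineSpan ℝ {A₁, A₂}) ∩ tri V 2 : Set E) = ∅)
    (hlC : (↑(affineSpan ℝ {C₁, C₂}) ∩ tri V 2 : Set E) = ∅) :
    Poised V 1 3 {A₁, A₂, B, C₁, C₂} := by
  have I1 := hV.indep 1 (by norm_num) (by norm_num)
  have I2 := hV.indep 2 (by norm_num) (by norm_num)
  have I3 := hV.indep 3 (by norm_num) (by norm_num)
  have mem1 := tri_subset_stripSet V (show 1 ∈ Finset.Icc 1 3 by simp)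
  have mem2 := tri_subset_stripSet V (show 2 ∈ Finset.Icc 1 3 by simp)
  have mem3 := tri_subset_stripSet V (show 3 ∈ Finset.Icc 1 3 by simp)
  intro c
  refine existsUnique_of_exists_of_unique ?_ ?_
  · let F := planeInterp _ I1 ![0, 1, 2]
    let G := planeInterp _ I2 ![1, 2, 3]
    let H := planeInterp _ I3 ![2, 3, 4]
    have FG2 w : F w (V 2) = G w (V 2) :=
      (planeInterp_vertex _ I1 ![0, 1, 2] w 1).trans
        (planeInterp_vertex _ I2 ![1, 2, 3] w 0).symm
    have FG3 w : F w (V 3) = G w (V 3) :=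
      (planeInterp_vertex _ I1 ![0, 1, 2] w 2).trans
        (planeInterp_vertex _ I2 ![1, 2, 3] w 1).symm
    have GH3 w : G w (V 3) = H w (V 3) :=
      (planeInterp_vertex _ I2 ![1, 2, 3] w 1).trans
        (planeInterp_vertex _ I3 ![2, 3, 4] w 0).symm
    have GH4 w : G w (V 4) = H w (V 4) :=
      (planeInterp_vertex _ I2 ![1, 2, 3] w 2).trans
        (planeInterp_vertex _ I3 ![2, 3, 4] w 1).symm
    let L : (Fin 5 → ℝ) →ₗ[ℝ] (Fin 5 → ℝ) :=
      { toFun := fun w => ![F w A₁, F w A₂, G w B, H w C₁, H w C₂]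
        map_add' := fun v w => by simp
        map_smul' := fun r w => by simp }
    have hinj : Function.Injective L := by
      rw [← LinearMap.ker_eq_bot, LinearMap.ker_eq_bot']
      intro w hw
      obtain ⟨hF, hG, hH⟩ := pieces_eq_zero V hV A₁ A₂ B C₁ C₂ hA hB hC hlA hlC
        (F w) (G w) (H w) (FG2 w) (FG3 w) (GH3 w) (GH4 w)
        (congrFun hw 0) (congrFun hw 1) (congrFun hw 2) (congrFun hw 3) (congrFun hw 4)
      ext j
      fin_cases j
      · exact (planeInterp_vertex _ I1 ![0, 1, 2] w 0).symm.trans (hF _)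
      · exact (planeInterp_vertex _ I1 ![0, 1, 2] w 1).symm.trans (hF _)
      · exact (planeInterp_vertex _ I1 ![0, 1, 2] w 2).symm.trans (hF _)
      · exact (planeInterp_vertex _ I3 ![2, 3, 4] w 1).symm.trans (hH _)
      · exact (planeInterp_vertex _ I3 ![2, 3, 4] w 2).symm.trans (hH _)
    obtain ⟨w, hw⟩ := LinearMap.surjective_of_injective hinj ![c A₁, c A₂, c B, c C₁, c C₂]
    obtain ⟨s, hs, s1, s2, s3⟩ :=
      exists_glue V hV (F w) (G w) (H w) (FG2 w) (FG3 w) (GH3 w) (GH4 w)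
    refine ⟨s, hs, fun ⟨a, _⟩ ha => ?_⟩
    simp only [Finset.mem_insert, Finset.mem_singleton] at ha
    rcases ha with rfl | rfl | rfl | rfl | rfl
    · exact (s1 _ hA₁).trans (congrFun hw 0)
    · exact (s1 _ hA₂).trans (congrFun hw 1)
    · exact (s2 _ hB).trans (congrFun hw 2)
    · exact (s3 _ hC₁).trans (congrFun hw 3)
    · exact (s3 _ hC₂).trans (congrFun hw 4)
  · rintro s t ⟨hs, hsc⟩ ⟨ht, htc⟩
    have hd : ∀ a : stripSet V 1 3, (a : E) ∈ ({A₁, A₂, B, C₁, C₂} : Finset E) →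
        (s - t) a = 0 := fun a ha => by simp only [Pi.sub_apply, hsc a ha, htc a ha, sub_self]
    obtain ⟨-, hp⟩ := (stripSpace V 1 3).sub_mem hs ht
    obtain ⟨f, hf⟩ := hp 1 (by simp)
    obtain ⟨g, hg⟩ := hp 2 (by simp)
    obtain ⟨h, hh⟩ := hp 3 (by simp)
    obtain ⟨-, v12, v13⟩ := tri_vertices_mem V 1
    obtain ⟨v22, v23, v24⟩ := tri_vertices_mem V 2
    obtain ⟨v33, v34, -⟩ := tri_vertices_mem V 3
    obtain ⟨hF, hG, hH⟩ := pieces_eq_zero V hV A₁ A₂ B C₁ C₂ hA hB hC hlA hlC f g h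
      ((hf ⟨V 2, mem1 v12⟩ v12).symm.trans (hg ⟨V 2, mem1 v12⟩ v22))
      ((hf ⟨V 3, mem1 v13⟩ v13).symm.trans (hg ⟨V 3, mem1 v13⟩ v23))
      ((hg ⟨V 3, mem1 v13⟩ v23).symm.trans (hh ⟨V 3, mem1 v13⟩ v33))
      ((hg ⟨V 4, mem2 v24⟩ v24).symm.trans (hh ⟨V 4, mem2 v24⟩ v34))
      ((hf ⟨A₁, mem1 hA₁⟩ hA₁).symm.trans (hd _ (by simp)))
      ((hf ⟨A₂, mem1 hA₂⟩ hA₂).symm.trans (hd _ (by simp)))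
      ((hg ⟨B, mem2 hB⟩ hB).symm.trans (hd _ (by simp)))
      ((hh ⟨C₁, mem3 hC₁⟩ hC₁).symm.trans (hd _ (by simp)))
      ((hh ⟨C₂, mem3 hC₂⟩ hC₂).symm.trans (hd _ (by simp)))
    refine sub_eq_zero.1 (funext fun x => ?_)
    obtain ⟨i, hi, hx⟩ := Set.mem_iUnion₂.1 x.2
    rw [Finset.mem_Icc] at hi
    obtain ⟨hi1, hi3⟩ := hi
    interval_cases i
    exacts [(hf x hx).trans (hF _), (hg x hx).trans (hG _), (hh x hx).trans (hH _)]
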